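/- For every F ∈ Δ₂(m,σ²) there exists F̃ ∈ Δ₂(m,σ²) with F̃(v) = 0 for all v < c (i.e. F̃ puts no mass below c) such that R(F̃,c) ≤ R(F,c). Concretely, one may take β := (m − c)/∫_c^∞(1 − F(v))dv ∈ (0,1] and F̃(v) := 0 for v < c and F̃(v) := β·F(v) + (1 − β) for v ≥ c; F is a mean-preserving spread of F̃, so F̃ also satisfies the variance constraint. -/

import Mathlib

open MeasureTheory Set Filter

/-- Expected revenue of a second-price auction with `n` bidders, seller's valuation `c`,
value cdf `F` and reserve price `r`. -/
noncomputable def revenue (n : ℕ) (c : ℝ) (F : ℝ → ℝ) (r : ℝ) : ℝ :=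
  r - (r - c) * F r ^ n +
    ∫ v in Set.Ioi r, (1 - (n : ℝ) * F v ^ (n - 1) + ((n : ℝ) - 1) * F v ^ n)

/-- The set of cdfs of nonnegative random variables with mean `m` and variance at most `σ²`. -/
def Delta2 (m σ : ℝ) (F : ℝ → ℝ) : Prop :=
  Monotone F ∧ (∀ x, ContinuousWithinAt F (Set.Ici x) x) ∧
    (∀ v < 0, F v = 0) ∧ Filter.Tendsto F Filter.atTop (nhds 1) ∧
    (∫ v in Set.Ioi (0:ℝ), (1 - F v)) = m ∧
    (∫ v in Set.Ioi (0:ℝ), 2 * v * (1 - F v)) ≤ m ^ 2 + σ ^ 2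

/-- The polynomial `1 - n x^(n-1) + (n-1) x^n` in the revenue formula is antitone on `[0, 1]`. -/
lemma antitoneOn_revenueIntegrand (n : ℕ) (hn : 2 ≤ n) :
    AntitoneOn (fun x : ℝ => 1 - (n : ℝ) * x ^ (n - 1) + ((n : ℝ) - 1) * x ^ n)
      (Set.Icc 0 1) := by
  obtain ⟨k, rfl⟩ := Nat.exists_eq_add_of_le' hn
  have hd : ∀ x : ℝ, HasDerivAt
      (fun x : ℝ => 1 - ((k + 2 : ℕ) : ℝ) * x ^ (k + 2 - 1) + (((k + 2 : ℕ) : ℝ) - 1) * x ^ (k + 2))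
      (-((k + 2 : ℝ) * (k + 1) * x ^ k * (1 - x))) x := by
    intro x
    have h := (((hasDerivAt_pow (k + 1) x).const_mul ((k + 2 : ℕ) : ℝ)).const_sub 1).add
      ((hasDerivAt_pow (k + 2) x).const_mul (((k + 2 : ℕ) : ℝ) - 1))
    refine h.congr_deriv ?_
    simp only [show k + 1 - 1 = k from rfl, show k + 2 - 1 = k + 1 from rfl]
    push_cast
    ring
  refine antitoneOn_of_deriv_nonpos (convex_Icc 0 1)
    (fun x _ => (hd x).continuousAt.continuousWithinAt)
    (fun x _ => (hd x).differentiableAt.differentiableWithinAt) ?_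
  intro x hx
  rw [interior_Icc] at hx
  rw [(hd x).deriv, neg_nonpos]
  have h0 := hx.1.le
  have h1 : 0 ≤ 1 - x := by linarith [hx.2]
  positivity

lemma revenueIntegrand_nonneg (n : ℕ) (hn : 2 ≤ n) {x : ℝ} (hx : x ∈ Set.Icc (0 : ℝ) 1) :
    0 ≤ 1 - (n : ℝ) * x ^ (n - 1) + ((n : ℝ) - 1) * x ^ n := by
  have h := antitoneOn_revenueIntegrand n hn hx (Set.right_mem_Icc.2 zero_le_one) hx.2
  simpa using h

lemma revenueIntegrand_le (n : ℕ) (hn : 2 ≤ n) {x : ℝ} (hx : x ∈ Set.Icc (0 : ℝ) 1) :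
    1 - (n : ℝ) * x ^ (n - 1) + ((n : ℝ) - 1) * x ^ n ≤ n * (1 - x) := by
  have hb := one_add_mul_le_pow (a := x - 1) (by linarith [hx.1]) n
  rw [add_sub_cancel] at hb
  have hp : x ^ n = x ^ (n - 1) * x := (pow_sub_one_mul (by omega) x).symm
  have h : 0 ≤ (n : ℝ) * x ^ (n - 1) * (1 - x) :=
    mul_nonneg (mul_nonneg n.cast_nonneg (pow_nonneg hx.1 _)) (sub_nonneg.2 hx.2)
  rw [hp] at hb ⊢
  nlinarith

theorem no_mass_below_c_delta2
    (n : ℕ) (hn : 2 ≤ n) (c m σ : ℝ)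
    (hc : 0 ≤ c) (hcm : c < m) (hσ : 0 < σ)
    (F : ℝ → ℝ) (hF : Delta2 m σ F) :
    let β : ℝ := (m - c) / ∫ v in Set.Ioi c, (1 - F v)
    let Ft : ℝ → ℝ := fun v => if v < c then 0 else β * F v + (1 - β)
    β ∈ Set.Ioc (0:ℝ) 1 ∧ Delta2 m σ Ft ∧ (∀ v < c, Ft v = 0) ∧
      revenue n c Ft c ≤ revenue n c F c := by
  intro β Ft
  obtain ⟨hmono, hrc, hneg, hlim, hmean, hvar⟩ := hF
  have hF1 : ∀ v, F v ≤ 1 := fun v => hmono.ge_of_tendsto hlim v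
  have hF0 : ∀ v, 0 ≤ F v := fun v => by
    rw [← hneg (min v (-1)) (by simp)]
    exact hmono (min_le_left _ _)
  have hFmem : ∀ v, F v ∈ Set.Icc (0 : ℝ) 1 := fun v => ⟨hF0 v, hF1 v⟩
  have hFmeas : Measurable F := hmono.measurable
  have hint : IntegrableOn (fun v => 1 - F v) (Ioi 0) := by
    by_contra h
    rw [integral_undef h] at hmean
    linarith
  have hint_c : IntegrableOn (fun v => 1 - F v) (Ioi c) := hint.mono_set (Ioi_subset_Ioi hc)
  have hint_0c : IntegrableOn (fun v => 1 - F v) (Ioc 0 c) := hint.mono_set Ioc_subset_Ioi_self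
  have hsplit : (∫ v in Ioc 0 c, (1 - F v)) + ∫ v in Ioi c, (1 - F v) = m := by
    rw [← hmean, ← Ioc_union_Ioi_eq_Ioi hc]
    exact (setIntegral_union Ioc_disjoint_Ioi_same measurableSet_Ioi hint_0c hint_c).symm
  have hone : (∫ _ in Ioc 0 c, (1 : ℝ)) = c := by simp [hc]
  have hone_int : IntegrableOn (fun _ : ℝ => (1 : ℝ)) (Ioc 0 c) := by simp
  have hle : (∫ v in Ioc 0 c, (1 - F v)) ≤ c :=
    (integral_mono hint_0c hone_int fun v => sub_le_self 1 (hF0 v)).trans_eq hone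
  have hA : m - c ≤ ∫ v in Ioi c, (1 - F v) := by linarith
  have hApos : 0 < ∫ v in Ioi c, (1 - F v) := by linarith
  have hβ0 : 0 < β := div_pos (by linarith) hApos
  have hβ1 : β ≤ 1 := (div_le_one hApos).2 hA
  have hβA : β * (∫ v in Ioi c, (1 - F v)) = m - c := div_mul_cancel₀ _ hApos.ne'
  have hFt_lt : ∀ v < c, Ft v = 0 := fun v hv => if_pos hv
  have hFt_ge : ∀ v, c ≤ v → Ft v = β * F v + (1 - β) := fun v hv => if_neg hv.not_gt
  have hFtF : ∀ v, c ≤ v → F v ≤ Ft v := fun v hv => by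
    rw [hFt_ge v hv]
    nlinarith [hF1 v]
  have hFtmem : ∀ v, Ft v ∈ Set.Icc (0 : ℝ) 1 := fun v => by
    rcases lt_or_ge v c with hv | hv
    · simp [hFt_lt v hv]
    · exact ⟨(hF0 v).trans (hFtF v hv), by rw [hFt_ge v hv]; nlinarith [hF1 v]⟩
  have hFtmono : Monotone Ft := fun a b hab => by
    rcases lt_or_ge a c with ha | ha
    · rw [hFt_lt a ha]
      exact (hFtmem b).1
    · rw [hFt_ge a ha, hFt_ge b (ha.trans hab)]
      gcongr
      exact hmono hab
  have heq_c : EqOn (fun v => β * (1 - F v)) (fun v => 1 - Ft v) (Ioi c) := fun v hv => by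
    simp only [hFt_ge v (le_of_lt hv)]
    ring
  have heq_0c : EqOn (fun _ => (1 : ℝ)) (fun v => 1 - Ft v) (Ioo 0 c) := fun v hv => by
    simp [hFt_lt v hv.2]
  have hFtint_c : IntegrableOn (fun v => 1 - Ft v) (Ioi c) :=
    IntegrableOn.congr_fun (hint_c.const_mul β) heq_c measurableSet_Ioi
  have hFtint_0c : IntegrableOn (fun v => 1 - Ft v) (Ioc 0 c) := by
    rw [integrableOn_Ioc_iff_integrableOn_Ioo] at hone_int ⊢
    exact hone_int.congr_fun heq_0c measurableSet_Ioo
  have hFtint : IntegrableOn (fun v => 1 - Ft v) (Ioi 0) := by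
    rw [← Ioc_union_Ioi_eq_Ioi hc]
    exact hFtint_0c.union hFtint_c
  have hFtmean : (∫ v in Ioi (0 : ℝ), (1 - Ft v)) = m := by
    rw [← Ioc_union_Ioi_eq_Ioi hc,
      setIntegral_union Ioc_disjoint_Ioi_same measurableSet_Ioi hFtint_0c hFtint_c,
      ← setIntegral_congr_fun measurableSet_Ioi heq_c, integral_const_mul, hβA,
      integral_Ioc_eq_integral_Ioo, ← setIntegral_congr_fun measurableSet_Ioo heq_0c,
      ← integral_Ioc_eq_integral_Ioo, hone]
    ring
  refine ⟨⟨hβ0, hβ1⟩, ⟨hFtmono, ?_, fun v hv => hFt_lt v (hv.trans_le hc), ?_, hFtmean, ?_⟩,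
    hFt_lt, ?_⟩
  · intro x
    rcases lt_or_ge x c with hx | hx
    · refine (continuousAt_const (y := (0 : ℝ))).continuousWithinAt.congr_of_eventuallyEq
        ?_ (hFt_lt x hx)
      filter_upwards [mem_nhdsWithin_of_mem_nhds (Iio_mem_nhds hx)] with v hv using hFt_lt v hv
    · exact (((hrc x).const_mul β).add continuousWithinAt_const).congr
        (fun v hv => hFt_ge v (hx.trans hv)) (hFt_ge x hx)
  · have h : Tendsto (fun v => β * F v + (1 - β)) atTop (nhds 1) := by
      simpa using (hlim.const_mul β).add_const (1 - β)
    refine h.congr' ?_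
    filter_upwards [eventually_ge_atTop c] with v hv using (hFt_ge v hv).symm
  · by_cases hFt2 : IntegrableOn (fun v => 2 * v * (1 - Ft v)) (Ioi 0)
    · have hF2 : IntegrableOn (fun v => 2 * v * (1 - F v)) (Ioi 0) := by
        refine Integrable.mono' ((hFt2.const_mul β⁻¹).add (hint.const_mul (2 * c)))
          (by fun_prop) ?_
        filter_upwards [ae_restrict_mem measurableSet_Ioi] with v (hv : 0 < v)
        have h1 := sub_nonneg.2 (hF1 v)
        have h2 := sub_nonneg.2 (hFtmem v).2
        rw [Real.norm_of_nonneg (by positivity), Pi.add_apply]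
        rcases lt_or_ge v c with hvc | hvc
        · have : 0 ≤ β⁻¹ * (2 * v * (1 - Ft v)) := by positivity
          have : 2 * v * (1 - F v) ≤ 2 * c * (1 - F v) := by gcongr
          linarith
        · have : β⁻¹ * (2 * v * (1 - Ft v)) = 2 * v * (1 - F v) := by
            rw [hFt_ge v hvc]
            field_simp
            ring
          have : 0 ≤ 2 * c * (1 - F v) := by positivity
          linarith
      have hD : IntegrableOn (fun v => 2 * c * ((1 - F v) - (1 - Ft v))) (Ioi 0) :=
        (hint.sub hFtint).const_mul (2 * c)
      calc (∫ v in Ioi (0 : ℝ), 2 * v * (1 - Ft v))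
          ≤ ∫ v in Ioi (0 : ℝ), (2 * v * (1 - F v) - 2 * c * ((1 - F v) - (1 - Ft v))) := by
            refine integral_mono hFt2 (hF2.sub hD) fun v => ?_
            have h : 0 ≤ (v - c) * (Ft v - F v) := by
              rcases lt_or_ge v c with hvc | hvc
              · rw [hFt_lt v hvc]
                nlinarith [hF0 v]
              · exact mul_nonneg (sub_nonneg.2 hvc) (sub_nonneg.2 (hFtF v hvc))
            show 2 * v * (1 - Ft v) ≤ 2 * v * (1 - F v) - 2 * c * ((1 - F v) - (1 - Ft v))
            linarith
        _ = ∫ v in Ioi (0 : ℝ), 2 * v * (1 - F v) := by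
            rw [integral_sub hF2 hD, integral_const_mul, integral_sub hint hFtint, hmean, hFtmean]
            ring
        _ ≤ m ^ 2 + σ ^ 2 := hvar
    · rw [integral_undef hFt2]
      positivity
  · simp only [revenue, sub_self, zero_mul, sub_zero]
    gcongr 1
    refine integral_mono_of_nonneg (.of_forall fun v => revenueIntegrand_nonneg n hn (hFtmem v))
      ?_ ?_
    · refine Integrable.mono' (hint_c.const_mul n) (by fun_prop) (.of_forall fun v => ?_)
      rw [Real.norm_of_nonneg (revenueIntegrand_nonneg n hn (hFmem v))]
      exact revenueIntegrand_le n hn (hFmem v)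
    · filter_upwards [ae_restrict_mem measurableSet_Ioi] with v hv
      exact antitoneOn_revenueIntegrand n hn (hFmem v) (hFtmem v) (hFtF v (le_of_lt hv))
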